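/- Let G be a group of nilpotency class at most 2. Then G is absolutely closed in N₂ if and only if for all x, y ∈ G, every prime p, and every integer α ≥ 1, with n = p^α at least one of the following holds: (2.10) there exist integers a, b, c and elements g₁, g₂ ∈ G such that g₁^n ≡ x^a y^b (mod [G,G]), g₂^n ≡ x^b y^c (mod [G,G]), and [g₁,x][g₂,y] ≠ e; or (2.11) there exist integers a, b, c and elements g₁, g₂ ∈ G such that g₁^n ≡ x^a y^b (mod [G,G]) and g₂^n ≡ x^{b+1} y^c (mod [G,G]). -/

import Mathlib

universe u

/-- A group is nilpotent of class at most 2 (lies in `N₂`) if its commutator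
subgroup is contained in its center. -/
def IsNil2 (G : Type*) [Group G] : Prop :=
  commutator G ≤ Subgroup.center G

/-- The dominion of a subgroup `B` of `A` in the variety `N₂`: the set of `a ∈ A`
such that any two homomorphisms from `A` to a nil-2 group agreeing on `B` agree at `a`. -/
def Dominion {A : Type u} [Group A] (B : Subgroup A) : Set A :=
  {a | ∀ (C : Type u) [Group C], IsNil2 C →
    ∀ f g : A →* C, (∀ b ∈ B, f b = g b) → f a = g a}

/-- A group `B` is absolutely closed in `N₂` if for every nil-2 group `A`
containing (a copy of) `B` as a subgroup, the dominion of `B` in `A` is `B`. -/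
def IsAbsolutelyClosed (B : Type u) [Group B] : Prop :=
  ∀ (A : Type u) [Group A], IsNil2 A →
    ∀ ι : B →* A, Function.Injective ι →
      Dominion ι.range = (ι.range : Set A)

/-- Condition (2.10): there exist integers `a`, `b`, `c` and `g₁ g₂ ∈ G` with
`g₁ⁿ ≡ xᵃyᵇ (mod [G,G])`, `g₂ⁿ ≡ xᵇyᶜ (mod [G,G])` and `[g₁,x][g₂,y] ≠ e`. -/
def Cond210 {G : Type*} [Group G] (x y : G) (n : ℕ) : Prop :=
  ∃ (a b c : ℤ) (g₁ g₂ : G),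
    g₁ ^ n * (x ^ a * y ^ b)⁻¹ ∈ commutator G ∧
    g₂ ^ n * (x ^ b * y ^ c)⁻¹ ∈ commutator G ∧
    g₁⁻¹ * x⁻¹ * g₁ * x * (g₂⁻¹ * y⁻¹ * g₂ * y) ≠ 1

/-- Condition (2.11): there exist integers `a`, `b`, `c` and `g₁ g₂ ∈ G` with
`g₁ⁿ ≡ xᵃyᵇ (mod [G,G])` and `g₂ⁿ ≡ x^{b+1}yᶜ (mod [G,G])`. -/
def Cond211 {G : Type*} [Group G] (x y : G) (n : ℕ) : Prop :=
  ∃ (a b c : ℤ) (g₁ g₂ : G),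
    g₁ ^ n * (x ^ a * y ^ b)⁻¹ ∈ commutator G ∧
    g₂ ^ n * (x ^ (b + 1) * y ^ c)⁻¹ ∈ commutator G

open scoped commutatorElement

namespace Nil2Aux

theorem comm_mem_center {A : Type*} [Group A] (h : IsNil2 A) (a b : A) :
    ⁅a, b⁆ ∈ Subgroup.center A :=
  h (Subgroup.commutator_mem_commutator (Subgroup.mem_top a) (Subgroup.mem_top b))

theorem comm_mem {A : Type*} [Group A] (a b : A) : ⁅a, b⁆ ∈ commutator A :=
  Subgroup.commutator_mem_commutator (Subgroup.mem_top a) (Subgroup.mem_top b)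

theorem isNil2_of {A : Type*} [Group A] (h : ∀ a b c : A, ⁅a, b⁆ * c = c * ⁅a, b⁆) : IsNil2 A := by
  unfold IsNil2
  rw [commutator_def, Subgroup.commutator_le]
  intro a _ b _
  rw [Subgroup.mem_center_iff]
  intro c
  exact (h a b c).symm

theorem comm_mul_right {A : Type*} [Group A] (h : IsNil2 A) (a b c : A) :
    ⁅a, b * c⁆ = ⁅a, b⁆ * ⁅a, c⁆ := by
  have h1 := Subgroup.mem_center_iff.1 (comm_mem_center h a c) b
  calc ⁅a, b * c⁆ = ⁅a, b⁆ * (b * ⁅a, c⁆) * b⁻¹ := by simp only [commutatorElement_def]; group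
    _ = _ := by rw [h1]; group

theorem comm_mul_left {A : Type*} [Group A] (h : IsNil2 A) (a b c : A) :
    ⁅a * b, c⁆ = ⁅a, c⁆ * ⁅b, c⁆ := by
  have h1 := Subgroup.mem_center_iff.1 (comm_mem_center h b c) a
  have h2 := Subgroup.mem_center_iff.1 (comm_mem_center h b c) ⁅a, c⁆
  calc ⁅a * b, c⁆ = (a * ⁅b, c⁆) * a⁻¹ * ⁅a, c⁆ := by simp only [commutatorElement_def]; group
    _ = ⁅b, c⁆ * ⁅a, c⁆ := by rw [h1]; group
    _ = _ := h2.symm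

instance centerCommGroup (A : Type*) [Group A] : CommGroup (Subgroup.center A) :=
  { (inferInstance : Group (Subgroup.center A)) with
    mul_comm := fun a b => Subtype.ext (Subgroup.mem_center_iff.1 b.2 a) }

/-- The commutator as a bilinear map into the center. -/
def kk {A : Type*} [Group A] (h : IsNil2 A) : A →* A →* Subgroup.center A :=
  MonoidHom.mk' (fun a => MonoidHom.mk' (fun b => ⟨⁅a, b⁆, comm_mem_center h a b⟩)
    (fun b c => Subtype.ext (comm_mul_right h a b c)))
    (fun a b => MonoidHom.ext fun c => Subtype.ext (comm_mul_left h a b c))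

theorem kk_coe {A : Type*} [Group A] (h : IsNil2 A) (a b : A) :
    ((kk h a b : Subgroup.center A) : A) = ⁅a, b⁆ := rfl

theorem kk_self {A : Type*} [Group A] (h : IsNil2 A) (a : A) : kk h a a = 1 := by
  apply Subtype.ext; rw [kk_coe]; simp

theorem kk_swap {A : Type*} [Group A] (h : IsNil2 A) (a b : A) : kk h a b = (kk h b a)⁻¹ := by
  apply Subtype.ext
  rw [Subgroup.coe_inv, kk_coe, kk_coe, commutatorElement_inv]

theorem kk_comm {A : Type*} [Group A] (h : IsNil2 A) {d : A} (hd : d ∈ commutator A) :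
    kk h d = 1 := by
  apply MonoidHom.ext; intro b
  apply Subtype.ext; rw [kk_coe]
  have := Subgroup.mem_center_iff.1 (h hd) b
  exact commutatorElement_eq_one_iff_mul_comm.2 this.symm

theorem kk_congr {A : Type*} [Group A] (h : IsNil2 A) {d e : A} (hd : d * e⁻¹ ∈ commutator A) :
    kk h d = kk h e := by
  have := kk_comm h hd
  rw [map_mul, map_inv] at this
  exact mul_inv_eq_one.1 this

/-- The commutator of the informal statement agrees with `⁅ , ⁆`. -/
theorem comm_conv {A : Type*} [Group A] (h : IsNil2 A) (g x : A) :
    g⁻¹ * x⁻¹ * g * x = ⁅g, x⁆ := by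
  have : ((kk h g⁻¹ x⁻¹ : Subgroup.center A) : A) = kk h g x := by
    rw [map_inv, map_inv, MonoidHom.inv_apply, inv_inv]
  rw [kk_coe, kk_coe] at this
  rw [← this, commutatorElement_def]; group

theorem map_commutator_mem {A C : Type*} [Group A] [Group C] (f : A →* C) {d : A}
    (hd : d ∈ commutator A) : f d ∈ commutator C := by
  have : (commutator A).map f ≤ commutator C := by
    rw [commutator_def, Subgroup.map_commutator, commutator_def]
    exact Subgroup.commutator_mono le_top le_top
  exact this (Subgroup.mem_map_of_mem f hd)

/-- The easy half of the description of dominions. -/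
theorem comm_pow_mem_dominion {A : Type u} [Group A] (B : Subgroup A) (n : ℕ)
    (r s x y : A) (hx : x ∈ B) (hy : y ∈ B) (hr : r ^ n * x⁻¹ ∈ commutator A)
    (hs : s ^ n * y⁻¹ ∈ commutator A) : ⁅r, s⁆ ^ n ∈ Dominion B := by
  intro C _ hC f g hfg
  have key : ∀ f : A →* C, kk hC ((f r) ^ n) = kk hC (f x) ∧ kk hC ((f s) ^ n) = kk hC (f y) := by
    intro f
    constructor
    · apply kk_congr
      have := map_commutator_mem f hr
      simpa using this
    · apply kk_congr
      have := map_commutator_mem f hs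
      simpa using this
  have e1 : (kk hC (f r) (f s)) ^ n = (kk hC (g r) (f s)) ^ n := by
    rw [← MonoidHom.pow_apply, ← map_pow, (key f).1, hfg x hx, ← (key g).1, map_pow,
      MonoidHom.pow_apply]
  have e2 : (kk hC (f s) (g r)) ^ n = (kk hC (g s) (g r)) ^ n := by
    rw [← MonoidHom.pow_apply, ← map_pow, (key f).2, hfg y hy, ← (key g).2, map_pow,
      MonoidHom.pow_apply]
  have e3 : (kk hC (f r) (f s)) ^ n = (kk hC (g r) (g s)) ^ n := by
    rw [e1, kk_swap hC (g r) (f s), kk_swap hC (g r) (g s), inv_pow, e2, inv_pow]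
  have := congrArg (Subtype.val) e3
  rw [map_pow, map_pow, map_commutatorElement, map_commutatorElement]
  exact this

/-- The reduction step : inside an overgroup the conditions put `[r,s]^n` into `G`. -/
theorem comm_pow_mem_of_conds {G A : Type*} [Group G] [Group A] (hG : IsNil2 G) (hA : IsNil2 A)
    (i : G →* A) (hi : Function.Injective i)
    (n : ℕ) (x y : G) (h : Cond210 x y n ∨ Cond211 x y n) (r s : A)
    (hr : r ^ n * (i x)⁻¹ ∈ commutator A) (hs : s ^ n * (i y)⁻¹ ∈ commutator A) :
    ⁅r, s⁆ ^ n ∈ i.range := by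
  have hr' := kk_congr hA hr
  have hs' := kk_congr hA hs
  -- general computation
  have gen : ∀ (a b b' c : ℤ) (g₁ g₂ : G), g₁ ^ n * (x ^ a * y ^ b)⁻¹ ∈ commutator G →
      g₂ ^ n * (x ^ b' * y ^ c)⁻¹ ∈ commutator G →
      i (⁅g₁, x⁆ * ⁅g₂, y⁆) = (((kk hA r s) ^ ((n : ℤ) * (b' - b)) : Subgroup.center A) : A) := by
    intro a b b' c g₁ g₂ h1 h2
    have h1' := kk_congr hA (by simpa using map_commutator_mem i h1 :
      (i g₁) ^ n * ((i x) ^ a * (i y) ^ b)⁻¹ ∈ commutator A)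
    have h2' := kk_congr hA (by simpa using map_commutator_mem i h2 :
      (i g₂) ^ n * ((i x) ^ b' * (i y) ^ c)⁻¹ ∈ commutator A)
    have e1 : kk hA (i g₁) (i x) = (kk hA r s) ^ (-(n : ℤ) * b) := by
      rw [kk_swap, ← hr', ← kk_swap, map_pow, ← MonoidHom.pow_apply, ← map_pow, h1', map_mul,
        map_zpow, map_zpow, ← hr', ← hs', MonoidHom.mul_apply, MonoidHom.zpow_apply,
        MonoidHom.zpow_apply, map_pow, map_pow, MonoidHom.pow_apply, MonoidHom.pow_apply,
        kk_self, kk_swap hA s r, one_pow, one_zpow, one_mul, ← zpow_natCast, ← zpow_mul,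
        inv_zpow', neg_mul]
    have e2 : kk hA (i g₂) (i y) = (kk hA r s) ^ ((n : ℤ) * b') := by
      rw [kk_swap, ← hs', ← kk_swap, map_pow, ← MonoidHom.pow_apply, ← map_pow, h2', map_mul,
        map_zpow, map_zpow, ← hr', ← hs', MonoidHom.mul_apply, MonoidHom.zpow_apply,
        MonoidHom.zpow_apply, map_pow, map_pow, MonoidHom.pow_apply, MonoidHom.pow_apply,
        kk_self, one_pow, one_zpow, mul_one, ← zpow_natCast, ← zpow_mul]
    rw [map_mul, map_commutatorElement, map_commutatorElement, ← kk_coe hA, ← kk_coe hA,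
      ← Subgroup.coe_mul, e1, e2, ← zpow_add]
    congr 2; ring
  rcases h with ⟨a, b, c, g₁, g₂, h1, h2, h3⟩ | ⟨a, b, c, g₁, g₂, h1, h2⟩
  · exfalso
    apply h3
    rw [comm_conv hG, comm_conv hG]
    apply hi
    rw [gen a b b c g₁ g₂ h1 h2]
    simp
  · refine ⟨_, (gen a b (b + 1) c g₁ g₂ h1 h2).trans ?_⟩
    rw [show (n : ℤ) * (b + 1 - b) = (n : ℤ) by ring, zpow_natCast, Subgroup.coe_pow, kk_coe]

/-- From prime powers to all exponents. -/
theorem comm_pow_mem_all {A : Type*} [Group A] (hA : IsNil2 A) (B : Subgroup A)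
    (h : ∀ p : ℕ, p.Prime → ∀ α : ℕ, 1 ≤ α → ∀ r s : A, r ^ (p ^ α) ∈ B ⊔ commutator A →
      s ^ (p ^ α) ∈ B ⊔ commutator A → ⁅r, s⁆ ^ (p ^ α) ∈ B) (q : ℕ) :
    ∀ r s : A, r ^ q ∈ B ⊔ commutator A → s ^ q ∈ B ⊔ commutator A → ⁅r, s⁆ ^ q ∈ B := by
  induction q using Nat.recOnPosPrimePosCoprime with
  | prime_pow p α hp hα => exact h p hp α hα
  | zero => intro r s _ _; simp
  | one =>
    intro r s hr hs
    rw [pow_one] at *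
    rw [← SetLike.mem_coe, Subgroup.mul_normal, Set.mem_mul] at hr hs
    obtain ⟨b, hb, c, hc, rfl⟩ := hr
    obtain ⟨b', hb', c', hc', rfl⟩ := hs
    have : ⁅b * c, b' * c'⁆ = ⁅b, b'⁆ := by
      have e : kk hA (b * c) (b' * c') = kk hA b b' := by
        rw [map_mul (kk hA), kk_comm hA hc, mul_one, map_mul, kk_swap hA b c', kk_comm hA hc']
        simp
      exact congrArg Subtype.val e
    rw [this, commutatorElement_def]
    exact B.mul_mem (B.mul_mem (B.mul_mem hb hb') (B.inv_mem hb)) (B.inv_mem hb')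
  | coprime a b ha hb hab iha ihb =>
    intro r s hr hs
    have e : ∀ m k : ℕ, ⁅r ^ m, s ^ m⁆ ^ k = ⁅r, s⁆ ^ (m * m * k) := by
      intro m k
      have : kk hA (r ^ m) (s ^ m) ^ k = kk hA r s ^ (m * m * k) := by
        rw [map_pow, map_pow, MonoidHom.pow_apply, ← pow_mul, ← pow_mul, mul_assoc]
      have := congrArg Subtype.val this
      rwa [Subgroup.coe_pow, Subgroup.coe_pow, kk_coe, kk_coe] at this
    have h1 := iha (r ^ b) (s ^ b) (by rwa [← pow_mul, mul_comm]) (by rwa [← pow_mul, mul_comm])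
    have h2 := ihb (r ^ a) (s ^ a) (by rwa [← pow_mul]) (by rwa [← pow_mul])
    rw [e] at h1 h2
    have hbz := Nat.gcd_eq_gcd_ab a b
    rw [hab.gcd_eq_one] at hbz
    have : ⁅r, s⁆ ^ (a * b) = (⁅r, s⁆ ^ (b * b * a)) ^ (Nat.gcdB a b) *
        (⁅r, s⁆ ^ (a * a * b)) ^ (Nat.gcdA a b) := by
      rw [← zpow_natCast, ← zpow_natCast, ← zpow_natCast, ← zpow_mul, ← zpow_mul, ← zpow_add]
      congr 1
      push_cast at hbz ⊢
      linear_combination (a * b : ℤ) * hbz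
    rw [this]
    exact B.mul_mem (B.zpow_mem h1 _) (B.zpow_mem h2 _)

end Nil2Aux

namespace Nil2Aux

/-- The additively written abelianization. -/
def GA (G : Type*) [Group G] := Additive (Abelianization G)

instance (G : Type*) [Group G] : AddCommGroup (GA G) :=
  inferInstanceAs (AddCommGroup (Additive (Abelianization G)))

/-- The class of an element in the (additively written) abelianization. -/
def ob {G : Type*} [Group G] (g : G) : GA G :=
  Additive.ofMul (Abelianization.of g)

theorem ob_mul {G : Type*} [Group G] (g h : G) : ob (g * h) = ob g + ob h := by
  exact congrArg Additive.ofMul (map_mul Abelianization.of g h)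

theorem ob_one {G : Type*} [Group G] : ob (1 : G) = 0 := by
  exact congrArg Additive.ofMul (map_one Abelianization.of)

theorem ob_inv {G : Type*} [Group G] (g : G) : ob g⁻¹ = - ob g := by
  exact congrArg Additive.ofMul (map_inv Abelianization.of g)

theorem ob_zpow {G : Type*} [Group G] (g : G) (n : ℤ) : ob (g ^ n) = n • ob g := by
  exact congrArg Additive.ofMul (map_zpow Abelianization.of g n)

theorem ob_pow {G : Type*} [Group G] (g : G) (n : ℕ) : ob (g ^ n) = (n : ℤ) • ob g := by
  rw [← ob_zpow, zpow_natCast]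

theorem ob_eq_zero {G : Type*} [Group G] (g : G) : ob g = 0 ↔ g ∈ commutator G := by
  rw [← Abelianization.ker_of, MonoidHom.mem_ker]
  rfl

theorem ob_comm {G : Type*} [Group G] (g h : G) : ob ⁅g, h⁆ = 0 :=
  (ob_eq_zero _).2 (comm_mem g h)

/-- The nil-2 coproduct of `G` with the free nil-2 group on `r`, `s`. -/
@[ext] structure PP (G : Type u) [Group G] : Type u where
  /-- component in `G` -/
  w : G
  /-- exponent of `r` -/
  i : ℤ
  /-- exponent of `s` -/
  j : ℤ
  /-- coordinate of the commutators with `r` -/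
  al : GA G
  /-- coordinate of the commutators with `s` -/
  be : GA G
  /-- exponent of the commutator of `s` and `r` -/
  k : ℤ

namespace PP

variable {G : Type u} [Group G]

instance : Mul (PP G) := ⟨fun p q => ⟨p.w * q.w, p.i + q.i, p.j + q.j,
  p.al + q.al + p.i • ob q.w, p.be + q.be + p.j • ob q.w, p.k + q.k + p.j * q.i⟩⟩
instance : One (PP G) := ⟨⟨1, 0, 0, 0, 0, 0⟩⟩
instance : Inv (PP G) := ⟨fun p => ⟨p.w⁻¹, -p.i, -p.j, -p.al + p.i • ob p.w, -p.be + p.j • ob p.w,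
  -p.k + p.j * p.i⟩⟩

theorem mul_w (p q : PP G) : (p * q).w = p.w * q.w := rfl
theorem mul_i (p q : PP G) : (p * q).i = p.i + q.i := rfl
theorem mul_j (p q : PP G) : (p * q).j = p.j + q.j := rfl
theorem mul_al (p q : PP G) : (p * q).al = p.al + q.al + p.i • ob q.w := rfl
theorem mul_be (p q : PP G) : (p * q).be = p.be + q.be + p.j • ob q.w := rfl
theorem mul_k (p q : PP G) : (p * q).k = p.k + q.k + p.j * q.i := rfl
theorem one_w : (1 : PP G).w = 1 := rfl
theorem one_i : (1 : PP G).i = 0 := rfl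
theorem one_j : (1 : PP G).j = 0 := rfl
theorem one_al : (1 : PP G).al = 0 := rfl
theorem one_be : (1 : PP G).be = 0 := rfl
theorem one_k : (1 : PP G).k = 0 := rfl
theorem inv_w (p : PP G) : (p⁻¹).w = p.w⁻¹ := rfl
theorem inv_i (p : PP G) : (p⁻¹).i = -p.i := rfl
theorem inv_j (p : PP G) : (p⁻¹).j = -p.j := rfl
theorem inv_al (p : PP G) : (p⁻¹).al = -p.al + p.i • ob p.w := rfl
theorem inv_be (p : PP G) : (p⁻¹).be = -p.be + p.j • ob p.w := rfl
theorem inv_k (p : PP G) : (p⁻¹).k = -p.k + p.j * p.i := rfl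

instance : Group (PP G) := Group.ofLeftAxioms
  (by
    intro p q r
    ext
    · simp only [mul_w, mul_assoc]
    · simp only [mul_i, add_assoc]
    · simp only [mul_j, add_assoc]
    · simp only [mul_w, mul_i, mul_al, ob_mul]; module
    · simp only [mul_w, mul_j, mul_be, ob_mul]; module
    · simp only [mul_i, mul_j, mul_k]; ring)
  (by
    intro p
    ext
    · simp only [mul_w, one_w, one_mul]
    · simp only [mul_i, one_i, zero_add]
    · simp only [mul_j, one_j, zero_add]
    · simp only [mul_al, one_al, one_i]; module
    · simp only [mul_be, one_be, one_j]; module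
    · simp only [mul_k, one_k, one_j]; ring)
  (by
    intro p
    ext
    · simp only [mul_w, inv_w, one_w, inv_mul_cancel]
    · simp only [mul_i, inv_i, one_i, neg_add_cancel]
    · simp only [mul_j, inv_j, one_j, neg_add_cancel]
    · simp only [mul_al, inv_al, inv_i, one_al]; module
    · simp only [mul_be, inv_be, inv_j, one_be]; module
    · simp only [mul_k, inv_k, inv_j, one_k]; ring)

/-- Central elements of the coproduct. -/
theorem central {p : PP G} (hG : IsNil2 G) (hw : p.w ∈ commutator G) (hi : p.i = 0) (hj : p.j = 0)
    (q : PP G) : p * q = q * p := by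
  have h1 := (ob_eq_zero _).2 hw
  have h2 := Subgroup.mem_center_iff.1 (hG hw) q.w
  ext
  · simp only [mul_w]; exact h2.symm
  · simp only [mul_i]; ring
  · simp only [mul_j]; ring
  · simp only [mul_al, h1, hi]; module
  · simp only [mul_be, h1, hj]; module
  · simp only [mul_k, hi, hj]; ring

theorem comm_w (p q : PP G) : (⁅p, q⁆).w = ⁅p.w, q.w⁆ := by
  simp only [commutatorElement_def, mul_w, inv_w]

theorem comm_i (p q : PP G) : (⁅p, q⁆).i = 0 := by
  simp only [commutatorElement_def, mul_i, inv_i]; ring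

theorem comm_j (p q : PP G) : (⁅p, q⁆).j = 0 := by
  simp only [commutatorElement_def, mul_j, inv_j]; ring

theorem nil2 (hG : IsNil2 G) : IsNil2 (PP G) := by
  apply isNil2_of
  intro a b c
  apply central hG
  · rw [comm_w]; exact comm_mem _ _
  · exact comm_i _ _
  · exact comm_j _ _

/-- The embedding of `G`. -/
def emb : G →* PP G where
  toFun g := ⟨g, 0, 0, 0, 0, 0⟩
  map_one' := rfl
  map_mul' a b := by
    ext
    · simp only [mul_w]
    · simp only [mul_i, add_zero]
    · simp only [mul_j, add_zero]
    · simp only [mul_al]; module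
    · simp only [mul_be]; module
    · simp only [mul_k]; ring

/-- Projection to the exponent of `r`. -/
def ei : PP G →* Multiplicative ℤ where
  toFun p := Multiplicative.ofAdd p.i
  map_one' := rfl
  map_mul' _ _ := rfl

/-- Projection to the exponent of `s`. -/
def ej : PP G →* Multiplicative ℤ where
  toFun p := Multiplicative.ofAdd p.j
  map_one' := rfl
  map_mul' _ _ := rfl

/-- The central subgroup of relations forced by `rⁿ = x`, `sⁿ = y`. -/
def MM (hG : IsNil2 G) (x y : G) (n : ℕ) : Subgroup (PP G) where
  carrier := {p | ∃ (g h : G) (a b b' c : ℤ), p = ⟨⁅g, x⁆ * ⁅h, y⁆, 0, 0,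
    (n : ℤ) • ob g + a • ob x + b • ob y, (n : ℤ) • ob h + b' • ob x + c • ob y,
    (n : ℤ) * (b - b')⟩}
  one_mem' := ⟨1, 1, 0, 0, 0, 0, by
    ext
    · simp [one_w]
    · rfl
    · rfl
    · simp only [one_al, ob_one]; module
    · simp only [one_be, ob_one]; module
    · simp only [one_k]; ring⟩
  mul_mem' := by
    rintro _ _ ⟨g, h, a, b, b', c, rfl⟩ ⟨g', h', d, e, e', f, rfl⟩
    refine ⟨g * g', h * h', a + d, b + e, b' + e', c + f, ?_⟩
    ext
    · simp only [mul_w]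
      rw [comm_mul_left hG, comm_mul_left hG]
      have := Subgroup.mem_center_iff.1 (comm_mem_center hG g' x) ⁅h, y⁆
      calc _ = ⁅g, x⁆ * (⁅h, y⁆ * ⁅g', x⁆) * ⁅h', y⁆ := by group
        _ = _ := by rw [this]; group
    · simp only [mul_i, add_zero]
    · simp only [mul_j, add_zero]
    · simp only [mul_al, ob_mul]; module
    · simp only [mul_be, ob_mul]; module
    · simp only [mul_k]; ring
  inv_mem' := by
    rintro _ ⟨g, h, a, b, b', c, rfl⟩
    refine ⟨g⁻¹, h⁻¹, -a, -b, -b', -c, ?_⟩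
    ext
    · simp only [inv_w]
      have e : ∀ u v : G, ⁅u⁻¹, v⁆ = ⁅u, v⁆⁻¹ := by
        intro u v
        have := congrArg Subtype.val (DFunLike.congr_fun (map_inv (kk hG) u) v)
        exact this
      have := Subgroup.mem_center_iff.1 (comm_mem_center hG h⁻¹ y) ⁅g⁻¹, x⁆
      rw [this, e, e, mul_inv_rev]
    · simp only [inv_i, neg_zero]
    · simp only [inv_j, neg_zero]
    · simp only [inv_al, ob_inv]; module
    · simp only [inv_be, ob_inv]; module
    · simp only [inv_k]; ring

theorem MM_central (hG : IsNil2 G) (x y : G) (n : ℕ) {p : PP G} (hp : p ∈ MM hG x y n) (q : PP G) :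
    p * q = q * p := by
  obtain ⟨g, h, a, b, b', c, rfl⟩ := hp
  exact central hG ((commutator G).mul_mem (comm_mem _ _) (comm_mem _ _)) rfl rfl q

instance MM_normal (hG : IsNil2 G) (x y : G) (n : ℕ) : (MM hG x y n).Normal := by
  constructor
  intro p hp q
  rw [← MM_central hG x y n hp q]
  simpa using hp

/-- `x⁻¹ rⁿ` -/
def z1 (x : G) (n : ℕ) : PP G := ⟨x⁻¹, n, 0, 0, 0, 0⟩
/-- `y⁻¹ sⁿ` -/
def z2 (y : G) (n : ℕ) : PP G := ⟨y⁻¹, 0, n, 0, 0, 0⟩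

theorem z1_comm (hG : IsNil2 G) (x y : G) (n : ℕ) (p : PP G) :
    ∃ m ∈ MM hG x y n, z1 x n * p = p * z1 x n * m := by
  refine ⟨_, ⟨p.w, 1, p.i, 0, p.j, 0, rfl⟩, ?_⟩
  ext
  · simp only [mul_w, z1]
    rw [commutatorElement_one_left, mul_one, ← comm_conv hG]
    have := Subgroup.mem_center_iff.1 (comm_mem_center hG p.w x) x⁻¹
    rw [← comm_conv hG] at this
    rw [mul_assoc, this]; group
  · simp only [mul_i, z1]; ring
  · simp only [mul_j, z1]; ring
  · simp only [mul_al, mul_i, mul_w, z1, ob_inv, ob_comm, ob_mul]; module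
  · simp only [mul_be, mul_j, mul_w, z1, ob_inv, ob_one, ob_comm, ob_mul]; module
  · simp only [mul_k, mul_j, z1]; ring

theorem z2_comm (hG : IsNil2 G) (x y : G) (n : ℕ) (p : PP G) :
    ∃ m ∈ MM hG x y n, z2 y n * p = p * z2 y n * m := by
  refine ⟨_, ⟨1, p.w, 0, p.i, 0, p.j, rfl⟩, ?_⟩
  ext
  · simp only [mul_w, z2]
    rw [commutatorElement_one_left, one_mul, ← comm_conv hG]
    have := Subgroup.mem_center_iff.1 (comm_mem_center hG p.w y) y⁻¹
    rw [← comm_conv hG] at this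
    rw [mul_assoc, this]; group
  · simp only [mul_i, z2]; ring
  · simp only [mul_j, z2]; ring
  · simp only [mul_al, mul_i, mul_w, z2, ob_inv, ob_one, ob_comm, ob_mul]; module
  · simp only [mul_be, mul_j, mul_w, z2, ob_inv, ob_comm, ob_mul]; module
  · simp only [mul_k, mul_j, z2]; ring

end PP

theorem nil2_of_surjective {A C : Type*} [Group A] [Group C] (f : A →* C)
    (hf : Function.Surjective f) (hA : IsNil2 A) : IsNil2 C := by
  apply isNil2_of
  intro a b c
  obtain ⟨a, rfl⟩ := hf a
  obtain ⟨b, rfl⟩ := hf b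
  obtain ⟨c, rfl⟩ := hf c
  rw [← map_commutatorElement, ← map_mul, ← map_mul]
  rw [Subgroup.mem_center_iff.1 (comm_mem_center hA a b) c]

theorem zpowers_normal {A : Type*} [Group A] {z : A} (h : ∀ p, z * p = p * z) :
    (Subgroup.zpowers z).Normal := by
  constructor
  rintro _ ⟨k, rfl⟩ q
  have : Commute (z ^ k) q := Commute.zpow_left (h q) k
  refine ⟨k, ?_⟩
  simp only
  rw [← this.eq]; group

/-- If both conditions fail, `G` is not absolutely closed. -/
theorem conds_of_closed {G : Type u} [Group G] (hG : IsNil2 G) (hcl : IsAbsolutelyClosed G)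
    (x y : G) (n : ℕ) (hn : n ≠ 0) : Cond210 x y n ∨ Cond211 x y n := by
  by_contra hcon
  push Not at hcon
  obtain ⟨h210, h211⟩ := hcon
  have hnz : (n : ℤ) ≠ 0 := by exact_mod_cast hn
  let M := PP.MM hG x y n
  let K := PP G ⧸ M
  let π : PP G →* K := QuotientGroup.mk' M
  have hπ : Function.Surjective π := QuotientGroup.mk'_surjective M
  have hK : IsNil2 K := nil2_of_surjective π hπ (PP.nil2 hG)
  have hz1 : ∀ p, π (PP.z1 x n) * p = p * π (PP.z1 x n) := by
    intro p
    obtain ⟨p, rfl⟩ := hπ p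
    obtain ⟨m, hm, e⟩ := PP.z1_comm hG x y n p
    have hm' : π m = 1 := (QuotientGroup.eq_one_iff m).2 hm
    rw [← map_mul, e, map_mul, map_mul, hm', mul_one]
  have hz2 : ∀ p, π (PP.z2 y n) * p = p * π (PP.z2 y n) := by
    intro p
    obtain ⟨p, rfl⟩ := hπ p
    obtain ⟨m, hm, e⟩ := PP.z2_comm hG x y n p
    have hm' : π m = 1 := (QuotientGroup.eq_one_iff m).2 hm
    rw [← map_mul, e, map_mul, map_mul, hm', mul_one]
  haveI := zpowers_normal hz1
  haveI := zpowers_normal hz2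
  let Z := Subgroup.zpowers (π (PP.z1 x n)) ⊔ Subgroup.zpowers (π (PP.z2 y n))
  haveI : Z.Normal := inferInstance
  let A := K ⧸ Z
  let ρ : K →* A := QuotientGroup.mk' Z
  have hA : IsNil2 A := nil2_of_surjective ρ (QuotientGroup.mk'_surjective Z) hK
  let θ : PP G →* A := ρ.comp π
  -- the kernel of the composite
  have ker : ∀ p : PP G, p.i = 0 → p.j = 0 → θ p = 1 → p ∈ M := by
    intro p hi hj hp
    have h1 : π p ∈ Z := (QuotientGroup.eq_one_iff (π p)).1 hp
    rw [← SetLike.mem_coe, Subgroup.mul_normal, Set.mem_mul] at h1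
    obtain ⟨_, ⟨a, rfl⟩, _, ⟨b, rfl⟩, e⟩ := h1
    simp only at e
    rw [← map_zpow, ← map_zpow, ← map_mul] at e
    have e' := QuotientGroup.eq.1 e
    have e1 : ∀ q ∈ M, q.i = 0 ∧ q.j = 0 := by
      rintro _ ⟨g, h, a, b, b', c, rfl⟩
      exact ⟨rfl, rfl⟩
    obtain ⟨ea, eb⟩ := e1 _ e'
    have ea' := congrArg Multiplicative.ofAdd ea
    have eb' := congrArg Multiplicative.ofAdd eb
    change PP.ei _ = _ at ea'
    change PP.ej _ = _ at eb'
    rw [map_mul, map_inv, map_mul, map_zpow, map_zpow] at ea' eb'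
    have ta := congrArg Multiplicative.toAdd ea'
    have tb := congrArg Multiplicative.toAdd eb'
    simp [PP.ei, PP.ej, PP.z1, PP.z2, hi, hj, hn] at ta tb
    subst ta; subst tb
    simpa using e'
  let ι : G →* A := θ.comp PP.emb
  have hι : Function.Injective ι := by
    rw [injective_iff_map_eq_one]
    intro g hg
    obtain ⟨g', h, a, b, b', c, e⟩ := ker (PP.emb g) rfl rfl hg
    rw [PP.ext_iff] at e
    obtain ⟨e1, -, -, e2, e3, e4⟩ := e
    simp only [PP.emb, MonoidHom.coe_mk, OneHom.coe_mk] at e1 e2 e3 e4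
    have hb : b' = b := by
      rcases mul_eq_zero.1 e4.symm with h | h
      · exact absurd h hnz
      · omega
    subst hb
    by_contra hne
    apply h210
    refine ⟨-a, -b', -c, g', h, ?_, ?_, ?_⟩
    · rw [← ob_eq_zero, ob_mul, ob_inv, ob_mul, ob_pow, ob_zpow, ob_zpow, e2]; module
    · rw [← ob_eq_zero, ob_mul, ob_inv, ob_mul, ob_pow, ob_zpow, ob_zpow, e3]; module
    · rw [comm_conv hG, comm_conv hG, ← e1]; exact hne
  let r : PP G := ⟨1, 1, 0, 0, 0, 0⟩
  let s : PP G := ⟨1, 0, 1, 0, 0, 0⟩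
  have hrn : ∀ k : ℕ, r ^ k = ⟨1, k, 0, 0, 0, 0⟩ := by
    intro k
    induction k with
    | zero => rw [pow_zero]; ext <;> simp [PP.one_w, PP.one_i, PP.one_j, PP.one_al, PP.one_be, PP.one_k]
    | succ k ih =>
      rw [pow_succ, ih]
      ext <;> simp [r, PP.mul_w, PP.mul_i, PP.mul_j, PP.mul_al, PP.mul_be, PP.mul_k, ob_one]
  have hsn : ∀ k : ℕ, s ^ k = ⟨1, 0, k, 0, 0, 0⟩ := by
    intro k
    induction k with
    | zero => rw [pow_zero]; ext <;> simp [PP.one_w, PP.one_i, PP.one_j, PP.one_al, PP.one_be, PP.one_k]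
    | succ k ih =>
      rw [pow_succ, ih]
      ext <;> simp [s, PP.mul_w, PP.mul_i, PP.mul_j, PP.mul_al, PP.mul_be, PP.mul_k, ob_one]
  have hsr : ∀ k : ℕ, ⁅s, r⁆ ^ k = ⟨1, 0, 0, 0, 0, k⟩ := by
    have h1 : ⁅s, r⁆ = ⟨1, 0, 0, 0, 0, 1⟩ := by
      ext <;> simp [r, s, commutatorElement_def, PP.mul_w, PP.mul_i, PP.mul_j, PP.mul_al, PP.mul_be,
        PP.mul_k, ob_one, PP.inv_w, PP.inv_i, PP.inv_j, PP.inv_al, PP.inv_be, PP.inv_k]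
    intro k
    rw [h1]
    induction k with
    | zero => rw [pow_zero]; ext <;> simp [PP.one_w, PP.one_i, PP.one_j, PP.one_al, PP.one_be, PP.one_k]
    | succ k ih =>
      rw [pow_succ, ih]
      ext <;> simp [PP.mul_w, PP.mul_i, PP.mul_j, PP.mul_al, PP.mul_be, PP.mul_k, ob_one]
  have θz1 : θ (PP.z1 x n) = 1 := (QuotientGroup.eq_one_iff _).2
    (Subgroup.mem_sup_left (Subgroup.mem_zpowers _))
  have θz2 : θ (PP.z2 y n) = 1 := (QuotientGroup.eq_one_iff _).2
    (Subgroup.mem_sup_right (Subgroup.mem_zpowers _))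
  have hr : θ r ^ n = ι x := by
    have e : PP.emb x * PP.z1 x n = r ^ n := by
      rw [hrn]
      ext <;> simp [PP.emb, PP.z1, PP.mul_w, PP.mul_i, PP.mul_j, PP.mul_al, PP.mul_be, PP.mul_k]
    rw [← map_pow, ← e, map_mul, θz1, mul_one]; rfl
  have hs : θ s ^ n = ι y := by
    have e : PP.emb y * PP.z2 y n = s ^ n := by
      rw [hsn]
      ext <;> simp [PP.emb, PP.z2, PP.mul_w, PP.mul_i, PP.mul_j, PP.mul_al, PP.mul_be, PP.mul_k]
    rw [← map_pow, ← e, map_mul, θz2, mul_one]; rfl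
  have hdom : ⁅θ s, θ r⁆ ^ n ∈ Dominion ι.range :=
    comm_pow_mem_dominion ι.range n (θ s) (θ r) (ι y) (ι x) ⟨y, rfl⟩ ⟨x, rfl⟩
      (by rw [hs, mul_inv_cancel]; exact Subgroup.one_mem _)
      (by rw [hr, mul_inv_cancel]; exact Subgroup.one_mem _)
  rw [hcl A hA ι hι] at hdom
  obtain ⟨g, hg⟩ := hdom
  rw [← map_commutatorElement, ← map_pow, hsr] at hg
  have hg' : θ (PP.emb g⁻¹ * ⟨1, 0, 0, 0, 0, n⟩) = 1 := by
    rw [map_mul, ← hg, map_inv, map_inv]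
    exact inv_mul_cancel (ι g)
  obtain ⟨g', h, a, b, b', c, e⟩ := ker _ rfl rfl hg'
  rw [PP.ext_iff] at e
  obtain ⟨-, -, -, e2, e3, e4⟩ := e
  simp only [PP.mul_al, PP.mul_be, PP.mul_k, PP.emb, MonoidHom.coe_mk, OneHom.coe_mk, zero_smul,
    add_zero, zero_add, zero_mul] at e2 e3 e4
  have hb : b' = b - 1 := by
    have : (n : ℤ) * (b - b' - 1) = 0 := by linear_combination -e4
    rcases mul_eq_zero.1 this with h | h
    · exact absurd h hnz
    · omega
  subst hb
  apply h211
  refine ⟨-a, -b, -c, g', h, ?_, ?_⟩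
  · rw [← ob_eq_zero, ob_mul, ob_inv, ob_mul, ob_pow, ob_zpow, ob_zpow]
    rw [← sub_eq_zero] at e2
    rw [← neg_eq_zero, ← e2]; module
  · rw [← ob_eq_zero, ob_mul, ob_inv, ob_mul, ob_pow, ob_zpow, ob_zpow]
    rw [← sub_eq_zero] at e3
    rw [← neg_eq_zero, ← e3]; module

end Nil2Aux

namespace Nil2Aux

/-- Splitting an alternating form on a free abelian group of finite rank. -/
theorem smith_split {F T : Type*} [AddCommGroup F] [AddCommGroup T] {m : ℕ}
    (b0 : Module.Basis (Fin m) ℤ F) (B : Submodule ℤ F) (ω : F →ₗ[ℤ] F →ₗ[ℤ] T)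
    (halt : ∀ a, ω a a = 0)
    (H : ∀ (q : ℕ) (r s : F), (q : ℤ) • r ∈ B → (q : ℤ) • s ∈ B → (q : ℤ) • ω r s = 0) :
    ∃ φ : F →ₗ[ℤ] F →ₗ[ℤ] T, (∀ a, ∀ b ∈ B, φ a b = 0) ∧ ∀ a c, φ a c - φ c a = ω a c := by
  classical
  obtain ⟨n, S⟩ := Submodule.smithNormalForm b0 B
  let e := S.bM
  have hd : ∃ d : Fin m → ℤ, (∀ i, d i • e i ∈ B) ∧ ∀ k, d (S.f k) = S.a k := by
    refine ⟨fun i => if h : ∃ k, S.f k = i then S.a h.choose else 0, ?_, ?_⟩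
    · intro i
      by_cases h : ∃ k, S.f k = i
      · simp only [h, dif_pos]
        have h1 := S.snf h.choose
        have h2 := (S.bN h.choose).2
        rw [h1, h.choose_spec] at h2
        exact h2
      · simp only [h, dif_neg, not_false_eq_true, zero_smul, B.zero_mem]
    · intro k
      have h : ∃ k', S.f k' = S.f k := ⟨k, rfl⟩
      simp only [h, dif_pos]
      rw [S.f.injective h.choose_spec]
  obtain ⟨d, hdB, hda⟩ := hd
  have hU : ∀ i j, ∃ u u' : T, d j • u = 0 ∧ d i • u' = 0 ∧ u - u' = ω (e i) (e j) := by
    intro i j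
    obtain ⟨k1, hk1⟩ := Int.dvd_lcm_left (d i) (d j)
    obtain ⟨k2, hk2⟩ := Int.dvd_lcm_right (d i) (d j)
    have hl := H (Int.lcm (d i) (d j)) (e i) (e j)
      (by rw [hk1, mul_comm, mul_smul]; exact B.smul_mem _ (hdB i))
      (by rw [hk2, mul_comm, mul_smul]; exact B.smul_mem _ (hdB j))
    by_cases hz : (Int.gcd (d i) (d j) : ℤ) = 0
    · have h0 : d i = 0 ∧ d j = 0 := by
        rw [Int.natCast_eq_zero, Int.gcd_eq_zero_iff] at hz
        exact hz
      exact ⟨ω (e i) (e j), 0, by rw [h0.2, zero_smul], by rw [h0.1, zero_smul], sub_zero _⟩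
    obtain ⟨d1, hd1⟩ := Int.gcd_dvd_left (a := d i) (b := d j)
    obtain ⟨d2, hd2⟩ := Int.gcd_dvd_right (a := d i) (b := d j)
    set g : ℤ := (Int.gcd (d i) (d j) : ℤ) with hg
    have hbz : g = d i * Int.gcdA (d i) (d j) + d j * Int.gcdB (d i) (d j) :=
      Int.gcd_eq_gcd_ab _ _
    set s := Int.gcdA (d i) (d j)
    set t := Int.gcdB (d i) (d j)
    have h1 : d1 * s + d2 * t = 1 := by
      apply mul_left_cancel₀ hz
      linear_combination -hbz - s * hd1 - t * hd2
    have hlg : (Int.lcm (d i) (d j) : ℤ) ∣ g * d1 * d2 := by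
      apply Int.coe_lcm_dvd
      · exact ⟨d2, by linear_combination -d2 * hd1⟩
      · exact ⟨d1, by linear_combination -d1 * hd2⟩
    obtain ⟨k, hk⟩ := hlg
    have hl' : (g * d1 * d2) • ω (e i) (e j) = 0 := by
      rw [hk, mul_comm, mul_smul, hl, smul_zero]
    refine ⟨(s * d1) • ω (e i) (e j), -((t * d2) • ω (e i) (e j)), ?_, ?_, ?_⟩
    · rw [← mul_smul, show d j * (s * d1) = s * (g * d1 * d2) by
        linear_combination s * d1 * hd2, mul_smul, hl', smul_zero]
    · rw [smul_neg, ← mul_smul, show d i * (t * d2) = t * (g * d1 * d2) by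
        linear_combination t * d2 * hd1, mul_smul, hl', smul_zero, neg_zero]
    · rw [sub_neg_eq_add, ← add_smul, show s * d1 + t * d2 = 1 by linear_combination h1, one_smul]
  choose U U' hU1 hU2 hU3 using hU
  have hskew : ∀ a c, ω a c = - ω c a := by
    intro a c
    have := halt (a + c)
    simp only [map_add, LinearMap.add_apply, halt, zero_add, add_zero] at this
    exact eq_neg_of_add_eq_zero_right this
  let u : Fin m → Fin m → T := fun i j => if i < j then U i j else if j < i then U' j i else 0
  have hu1 : ∀ i j, d j • u i j = 0 := by
    intro i j
    simp only [u]
    split_ifs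
    · exact hU1 i j
    · exact hU2 j i
    · exact smul_zero _
  have hu2 : ∀ i j, u i j - u j i = ω (e i) (e j) := by
    intro i j
    simp only [u]
    rcases lt_trichotomy i j with h | h | h
    · rw [if_pos h, if_neg h.not_gt, if_pos h]; exact hU3 i j
    · subst h; simp [halt]
    · rw [if_neg h.not_gt, if_pos h, if_pos h, hskew, ← hU3 j i]; abel
  let φ : F →ₗ[ℤ] F →ₗ[ℤ] T := e.constr ℤ (fun i => e.constr ℤ (u i))
  have hφ : ∀ i j, φ (e i) (e j) = u i j := by
    intro i j
    simp only [φ, Module.Basis.constr_basis]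
  refine ⟨φ, ?_, ?_⟩
  · have hb : φ.compr₂ (LinearMap.id) = φ := by ext; rfl
    have key : ∀ k, φ.flip (S.bN k : F) = 0 := by
      intro k
      apply e.ext
      intro i
      rw [S.snf k]
      change φ.flip (S.a k • e (S.f k)) (e i) = 0
      rw [LinearMap.flip_apply, map_smul, hφ, ← hda k]
      exact hu1 _ _
    have key2 : φ.flip.comp B.subtype = 0 := S.bN.ext (fun k => key k)
    intro a b hb
    have := LinearMap.congr_fun (LinearMap.congr_fun key2 ⟨b, hb⟩) a
    exact this
  · have : φ - φ.flip = ω := by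
      apply e.ext; intro i
      apply e.ext; intro j
      rw [LinearMap.sub_apply, LinearMap.sub_apply, LinearMap.flip_apply, hφ, hφ, hu2]
    intro a c
    rw [← this, LinearMap.sub_apply, LinearMap.sub_apply, LinearMap.flip_apply]

/-- A bimultiplicative pairing to an additive group. -/
structure Bil (A T : Type*) [Group A] [AddCommGroup T] where
  /-- the pairing -/
  f : A → A → T
  left : ∀ a a' c, f (a * a') c = f a c + f a' c
  right : ∀ a c c', f a (c * c') = f a c + f a c'

namespace Bil
variable {A T : Type*} [Group A] [AddCommGroup T] (φ : Bil A T)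

/-- left homomorphism -/
def lh (c : A) : A →* Multiplicative T :=
  MonoidHom.mk' (fun a => Multiplicative.ofAdd (φ.f a c)) (fun a b => by rw [φ.left]; rfl)

/-- right homomorphism -/
def rh (a : A) : A →* Multiplicative T :=
  MonoidHom.mk' (fun c => Multiplicative.ofAdd (φ.f a c)) (fun x y => by rw [φ.right]; rfl)

theorem one_left (c : A) : φ.f 1 c = 0 :=
  congrArg Multiplicative.toAdd (map_one (φ.lh c))
theorem one_right (c : A) : φ.f c 1 = 0 :=
  congrArg Multiplicative.toAdd (map_one (φ.rh c))
theorem inv_left (a c : A) : φ.f a⁻¹ c = - φ.f a c :=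
  congrArg Multiplicative.toAdd (map_inv (φ.lh c) a)
theorem inv_right (a c : A) : φ.f a c⁻¹ = - φ.f a c :=
  congrArg Multiplicative.toAdd (map_inv (φ.rh a) c)
theorem comm_left {a : A} (h : a ∈ commutator A) (c : A) : φ.f a c = 0 :=
  congrArg Multiplicative.toAdd
    (MonoidHom.mem_ker.1 (Abelianization.commutator_subset_ker (φ.lh c) h))
theorem comm_right {c : A} (h : c ∈ commutator A) (a : A) : φ.f a c = 0 :=
  congrArg Multiplicative.toAdd
    (MonoidHom.mem_ker.1 (Abelianization.commutator_subset_ker (φ.rh a) h))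

theorem congr_left {a a' : A} (h : ob a = ob a') (c : A) : φ.f a c = φ.f a' c := by
  have h1 : a * a'⁻¹ ∈ commutator A := by
    rw [← ob_eq_zero, ob_mul, ob_inv, h, add_neg_cancel]
  have := φ.comm_left h1 c
  rw [φ.left, φ.inv_left] at this
  exact add_neg_eq_zero.1 this

theorem congr_right {a a' : A} (h : ob a = ob a') (c : A) : φ.f c a = φ.f c a' := by
  have h1 : a * a'⁻¹ ∈ commutator A := by
    rw [← ob_eq_zero, ob_mul, ob_inv, h, add_neg_cancel]
  have := φ.comm_right h1 c
  rw [φ.right, φ.inv_right] at this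
  exact add_neg_eq_zero.1 this

end Bil

theorem ob_surjective {A : Type*} [Group A] (z : GA A) : ∃ a : A, ob a = z := by
  obtain ⟨a, ha⟩ := QuotientGroup.mk_surjective (Additive.toMul z : Abelianization A)
  exact ⟨a, congrArg Additive.ofMul ha⟩

/-- The finite version of the splitting of an alternating form. -/
theorem split_finite {A T : Type*} [Group A] [AddCommGroup T] (B : Subgroup A) (w : Bil A T)
    (halt : ∀ a, w.f a a = 0)
    (H : ∀ (q : ℕ) (r s : A), r ^ q ∈ B ⊔ commutator A → s ^ q ∈ B ⊔ commutator A →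
      (q : ℤ) • w.f r s = 0) (S : Finset A) :
    ∃ φ : A → A → T,
      (∀ a ∈ Subgroup.closure (S : Set A), ∀ a' ∈ Subgroup.closure (S : Set A),
        ∀ c ∈ Subgroup.closure (S : Set A), φ (a * a') c = φ a c + φ a' c) ∧
      (∀ a ∈ Subgroup.closure (S : Set A), ∀ c ∈ Subgroup.closure (S : Set A),
        ∀ c' ∈ Subgroup.closure (S : Set A), φ a (c * c') = φ a c + φ a c') ∧
      (∀ a ∈ Subgroup.closure (S : Set A), ∀ b ∈ Subgroup.closure (S : Set A), b ∈ B →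
        φ a b = 0) ∧
      (∀ a ∈ Subgroup.closure (S : Set A), ∀ c ∈ Subgroup.closure (S : Set A),
        φ a c - φ c a = w.f a c) := by
  classical
  let F := Fin S.card → ℤ
  let en : Fin S.card ≃ S := S.equivFin.symm
  let b0 : Module.Basis (Fin S.card) ℤ F := Pi.basisFun ℤ _
  let p : F →ₗ[ℤ] GA A := b0.constr ℤ (fun i => ob (en i : A))
  have hτ : ∀ u : F, ∃ a : A, ob a = p u := fun u => ob_surjective _
  choose τ hτ using hτ
  let ω0 : F →+ F →+ T := AddMonoidHom.mk' (fun u => AddMonoidHom.mk' (fun v => w.f (τ u) (τ v))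
    (fun v v' => by
      rw [← w.right]; apply w.congr_right; rw [ob_mul, hτ, hτ, hτ, map_add]))
    (fun u u' => by
      refine AddMonoidHom.ext fun v => ?_
      change w.f (τ (u + u')) (τ v) = w.f (τ u) (τ v) + w.f (τ u') (τ v)
      rw [← w.left]; apply w.congr_left; rw [ob_mul, hτ, hτ, hτ, map_add])
  let ω : F →ₗ[ℤ] F →ₗ[ℤ] T := (AddMonoidHom.mk' (fun u => (ω0 u).toIntLinearMap) (fun u u' => by
      refine LinearMap.ext fun v => ?_
      change ω0 (u + u') v = ω0 u v + ω0 u' v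
      rw [map_add]; rfl)).toIntLinearMap
  have hω : ∀ u v, ω u v = w.f (τ u) (τ v) := fun u v => rfl
  let BF : Submodule ℤ F := AddSubgroup.toIntSubmodule
    { carrier := {u | ∃ b ∈ B, ob b = p u}
      zero_mem' := ⟨1, B.one_mem, by rw [ob_one, map_zero]⟩
      add_mem' := by
        rintro u v ⟨b, hb, e⟩ ⟨b', hb', e'⟩
        exact ⟨b * b', B.mul_mem hb hb', by rw [ob_mul, e, e', map_add]⟩
      neg_mem' := by
        rintro u ⟨b, hb, e⟩
        exact ⟨b⁻¹, B.inv_mem hb, by rw [ob_inv, e, map_neg]⟩ }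
  have hBF : ∀ u, u ∈ BF ↔ ∃ b ∈ B, ob b = p u := fun u => Iff.rfl
  have hpow : ∀ (q : ℕ) (u : F), (q : ℤ) • u ∈ BF → τ u ^ q ∈ B ⊔ commutator A := by
    intro q u hu
    obtain ⟨b, hb, e⟩ := (hBF _).1 hu
    rw [map_smul, ← hτ, ← ob_pow] at e
    have h1 : b⁻¹ * τ u ^ q ∈ commutator A := by
      rw [← ob_eq_zero, ob_mul, ob_inv, e, neg_add_cancel]
    have : τ u ^ q = b * (b⁻¹ * τ u ^ q) := by group
    rw [this]
    exact Subgroup.mul_mem _ (Subgroup.mem_sup_left hb) (Subgroup.mem_sup_right h1)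
  obtain ⟨φ, h1, h2⟩ := smith_split b0 BF ω (fun a => halt _)
    (fun q r s hr hs => H q _ _ (hpow q r hr) (hpow q s hs))
  have k0 : ∀ u, p u = 0 → ∀ v, φ v u = 0 := fun u hu v =>
    h1 v u ((hBF u).2 ⟨1, B.one_mem, by rw [ob_one, hu]⟩)
  have k1 : ∀ u, p u = 0 → ∀ v, φ u v = 0 := by
    intro u hu v
    have := h2 u v
    rw [k0 u hu v, sub_zero, hω] at this
    rw [this]
    apply w.comm_left
    rw [← ob_eq_zero, hτ, hu]
  have c0 : ∀ u u', p u = p u' → ∀ v, φ v u = φ v u' := by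
    intro u u' h v
    have := k0 (u - u') (by rw [map_sub, h, sub_self]) v
    rw [map_sub] at this
    exact sub_eq_zero.1 this
  have c1 : ∀ u u', p u = p u' → ∀ v, φ u v = φ u' v := by
    intro u u' h v
    have := k1 (u - u') (by rw [map_sub, h, sub_self]) v
    rw [map_sub, LinearMap.sub_apply] at this
    exact sub_eq_zero.1 this
  have hl : ∀ a : A, ∃ u : F, a ∈ Subgroup.closure (S : Set A) → p u = ob a := by
    intro a
    by_cases ha : a ∈ Subgroup.closure (S : Set A)
    · have : ∃ u : F, p u = ob a := by
        induction ha using Subgroup.closure_induction with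
        | mem x hx =>
          refine ⟨b0 (en.symm ⟨x, hx⟩), ?_⟩
          simp only [p, Module.Basis.constr_basis, Equiv.apply_symm_apply]
        | one => exact ⟨0, by rw [map_zero, ob_one]⟩
        | mul x y _ _ hx hy =>
          obtain ⟨u, hu⟩ := hx
          obtain ⟨v, hv⟩ := hy
          exact ⟨u + v, by rw [map_add, hu, hv, ob_mul]⟩
        | inv x _ hx =>
          obtain ⟨u, hu⟩ := hx
          exact ⟨-u, by rw [map_neg, hu, ob_inv]⟩
      obtain ⟨u, hu⟩ := this
      exact ⟨u, fun _ => hu⟩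
    · exact ⟨0, fun h => absurd h ha⟩
  choose l hl using hl
  refine ⟨fun a c => φ (l a) (l c), ?_, ?_, ?_, ?_⟩
  · intro a ha a' ha' c hc
    simp only
    rw [← LinearMap.add_apply, ← map_add]
    apply c1
    rw [map_add, hl _ ha, hl _ ha', hl _ (Subgroup.mul_mem _ ha ha'), ob_mul]
  · intro a ha c hc c' hc'
    simp only
    rw [← map_add]
    apply c0
    rw [map_add, hl _ hc, hl _ hc', hl _ (Subgroup.mul_mem _ hc hc'), ob_mul]
  · intro a ha b hb hbB
    exact h1 _ _ ((hBF _).2 ⟨b, hbB, (hl _ hb).symm⟩)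
  · intro a ha c hc
    simp only
    rw [h2, hω, w.congr_left (a' := a) (by rw [hτ, hl _ ha]),
      w.congr_right (a' := c) (by rw [hτ, hl _ hc])]

/-- The general splitting, by compactness. -/
theorem split_all {A T : Type*} [Group A] [AddCommGroup T] [TopologicalSpace T] [CompactSpace T]
    [T2Space T] [IsTopologicalAddGroup T] (B : Subgroup A) (w : Bil A T)
    (halt : ∀ a, w.f a a = 0)
    (H : ∀ (q : ℕ) (r s : A), r ^ q ∈ B ⊔ commutator A → s ^ q ∈ B ⊔ commutator A →
      (q : ℤ) • w.f r s = 0) :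
    ∃ φ : Bil A T, (∀ a, ∀ b ∈ B, φ.f a b = 0) ∧ ∀ a c, φ.f a c - φ.f c a = w.f a c := by
  classical
  let V : Finset A → Set (A → A → T) := fun S => {φ |
      (∀ a ∈ Subgroup.closure (S : Set A), ∀ a' ∈ Subgroup.closure (S : Set A),
        ∀ c ∈ Subgroup.closure (S : Set A), φ (a * a') c = φ a c + φ a' c) ∧
      (∀ a ∈ Subgroup.closure (S : Set A), ∀ c ∈ Subgroup.closure (S : Set A),
        ∀ c' ∈ Subgroup.closure (S : Set A), φ a (c * c') = φ a c + φ a c') ∧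
      (∀ a ∈ Subgroup.closure (S : Set A), ∀ b ∈ Subgroup.closure (S : Set A), b ∈ B →
        φ a b = 0) ∧
      (∀ a ∈ Subgroup.closure (S : Set A), ∀ c ∈ Subgroup.closure (S : Set A),
        φ a c - φ c a = w.f a c)}
  have hmono : ∀ S S', S ⊆ S' → V S' ⊆ V S := by
    intro S S' h φ hφ
    have hc : Subgroup.closure (S : Set A) ≤ Subgroup.closure (S' : Set A) :=
      Subgroup.closure_mono (by exact_mod_cast h)
    obtain ⟨q1, q2, q3, q4⟩ := hφ
    exact ⟨fun a ha a' ha' c hc' => q1 a (hc ha) a' (hc ha') c (hc hc'),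
      fun a ha a' ha' c hc' => q2 a (hc ha) a' (hc ha') c (hc hc'),
      fun a ha b hb => q3 a (hc ha) b (hc hb), fun a ha b hb => q4 a (hc ha) b (hc hb)⟩
  have hcl : ∀ S, IsClosed (V S) := by
    intro S
    have ev : ∀ a c : A, Continuous fun φ : A → A → T => φ a c := fun a c =>
      (continuous_apply c).comp (continuous_apply a)
    simp only [V, Set.setOf_and, Set.setOf_forall]
    refine IsClosed.inter ?_ (IsClosed.inter ?_ (IsClosed.inter ?_ ?_))
    · exact isClosed_iInter fun a => isClosed_iInter fun _ => isClosed_iInter fun a' =>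
        isClosed_iInter fun _ => isClosed_iInter fun c => isClosed_iInter fun _ =>
        isClosed_eq (ev _ _) ((ev _ _).add (ev _ _))
    · exact isClosed_iInter fun a => isClosed_iInter fun _ => isClosed_iInter fun a' =>
        isClosed_iInter fun _ => isClosed_iInter fun c => isClosed_iInter fun _ =>
        isClosed_eq (ev _ _) ((ev _ _).add (ev _ _))
    · exact isClosed_iInter fun a => isClosed_iInter fun _ => isClosed_iInter fun a' =>
        isClosed_iInter fun _ => isClosed_iInter fun _ => isClosed_eq (ev _ _) continuous_const
    · exact isClosed_iInter fun a => isClosed_iInter fun _ => isClosed_iInter fun a' =>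
        isClosed_iInter fun _ => isClosed_eq ((ev _ _).sub (ev _ _)) continuous_const
  have hne : (⋂ S, V S).Nonempty := by
    apply IsCompact.nonempty_iInter_of_directed_nonempty_isCompact_isClosed V
    · intro S S'
      exact ⟨S ∪ S', hmono _ _ Finset.subset_union_left, hmono _ _ Finset.subset_union_right⟩
    · intro S
      exact split_finite B w halt H S
    · intro S
      exact (hcl S).isCompact
    · exact hcl
  obtain ⟨φ, hφ⟩ := hne
  rw [Set.mem_iInter] at hφ
  have mem3 : ∀ a b c : A, a ∈ Subgroup.closure ((({a, b, c} : Finset A)) : Set A) ∧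
      b ∈ Subgroup.closure ((({a, b, c} : Finset A)) : Set A) ∧
      c ∈ Subgroup.closure ((({a, b, c} : Finset A)) : Set A) := by
    intro a b c
    refine ⟨?_, ?_, ?_⟩ <;> exact Subgroup.subset_closure (by simp)
  refine ⟨⟨φ, ?_, ?_⟩, ?_, ?_⟩
  · intro a b c
    obtain ⟨ma, mb, mc⟩ := mem3 a b c
    exact (hφ {a, b, c}).1 a ma b mb c mc
  · intro a b c
    obtain ⟨ma, mb, mc⟩ := mem3 a b c
    exact (hφ {a, b, c}).2.1 a ma b mb c mc
  · intro a b hb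
    obtain ⟨ma, mb, mc⟩ := mem3 a b b
    exact (hφ {a, b, b}).2.2.1 a ma b mb hb
  · intro a b
    obtain ⟨ma, mb, mc⟩ := mem3 a b b
    exact (hφ {a, b, b}).2.2.2 a ma b mb

/-- The group detecting dominions (before passing to a quotient). -/
@[ext] structure DD {A : Type u} {T : Type} [Group A] [AddCommGroup T] (φ : Bil A T) : Type u where
  /-- first component -/
  y : A
  /-- second component -/
  v : A
  /-- central component -/
  t : T

namespace DD

variable {A : Type u} {T : Type} [Group A] [AddCommGroup T] {φ : Bil A T}

instance : Mul (DD φ) := ⟨fun p q => ⟨p.y * q.y, p.v * q.v, p.t + q.t + φ.f q.y p.v - φ.f q.v p.v⟩⟩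
instance : One (DD φ) := ⟨⟨1, 1, 0⟩⟩
instance : Inv (DD φ) := ⟨fun p => ⟨p.y⁻¹, p.v⁻¹, -p.t + φ.f p.y p.v - φ.f p.v p.v⟩⟩

theorem mul_y (p q : DD φ) : (p * q).y = p.y * q.y := rfl
theorem mul_v (p q : DD φ) : (p * q).v = p.v * q.v := rfl
theorem mul_t (p q : DD φ) : (p * q).t = p.t + q.t + φ.f q.y p.v - φ.f q.v p.v := rfl
theorem one_y : (1 : DD φ).y = 1 := rfl
theorem one_v : (1 : DD φ).v = 1 := rfl
theorem one_t : (1 : DD φ).t = 0 := rfl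
theorem inv_y (p : DD φ) : (p⁻¹).y = p.y⁻¹ := rfl
theorem inv_v (p : DD φ) : (p⁻¹).v = p.v⁻¹ := rfl
theorem inv_t (p : DD φ) : (p⁻¹).t = -p.t + φ.f p.y p.v - φ.f p.v p.v := rfl

instance : Group (DD φ) := Group.ofLeftAxioms
  (by
    intro p q r
    ext
    · simp only [mul_y, mul_assoc]
    · simp only [mul_v, mul_assoc]
    · simp only [mul_y, mul_v, mul_t, φ.left, φ.right]; abel)
  (by
    intro p
    ext
    · simp only [mul_y, one_y, one_mul]
    · simp only [mul_v, one_v, one_mul]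
    · simp only [mul_t, one_t, one_v, φ.one_right]; abel)
  (by
    intro p
    ext
    · simp only [mul_y, inv_y, one_y, inv_mul_cancel]
    · simp only [mul_v, inv_v, one_v, inv_mul_cancel]
    · simp only [mul_t, inv_t, inv_v, one_t, φ.inv_right]; abel)

theorem nil2 (hA : IsNil2 A) : IsNil2 (DD φ) := by
  apply isNil2_of
  intro a b c
  have hy : (⁅a, b⁆).y = ⁅a.y, b.y⁆ := rfl
  have hv : (⁅a, b⁆).v = ⁅a.v, b.v⁆ := rfl
  have hy' : (⁅a, b⁆).y ∈ commutator A := by rw [hy]; exact comm_mem _ _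
  have hv' : (⁅a, b⁆).v ∈ commutator A := by rw [hv]; exact comm_mem _ _
  ext
  · simp only [mul_y]; exact (Subgroup.mem_center_iff.1 (hA hy') c.y).symm
  · simp only [mul_v]; exact (Subgroup.mem_center_iff.1 (hA hv') c.v).symm
  · simp only [mul_t]
    rw [φ.comm_right hv', φ.comm_right hv', φ.comm_left hv', φ.comm_left hy']; abel

end DD

/-- The key step for the hard half of the description of dominions. -/
theorem dominion_step {A : Type u} {T : Type} [Group A] [AddCommGroup T] (hA : IsNil2 A)
    (B : Subgroup A) (χ : A → T)
    (hχ : ∀ c ∈ commutator A, ∀ c' ∈ commutator A, χ (c * c') = χ c + χ c')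
    (φ : Bil A T) (hφB : ∀ a, ∀ b ∈ B, φ.f a b = 0)
    (hφ : ∀ a c, φ.f a c - φ.f c a = χ ⁅a, c⁆) (a : A) (ha : a ∈ Dominion B) :
    ∃ b ∈ B, ∃ c ∈ commutator A, a = b * c ∧ χ c = 0 := by
  have χ1 : χ 1 = 0 := by
    have := hχ 1 (Subgroup.one_mem _) 1 (Subgroup.one_mem _)
    rw [mul_one] at this
    exact left_eq_add.1 this
  have χinv : ∀ c ∈ commutator A, χ c⁻¹ = - χ c := by
    intro c hc
    have := hχ c hc c⁻¹ (Subgroup.inv_mem _ hc)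
    rw [mul_inv_cancel, χ1] at this
    exact eq_neg_of_add_eq_zero_right this.symm
  have hcen : ∀ c ∈ commutator A, ∀ d : A, d * c = c * d := fun c hc d =>
    Subgroup.mem_center_iff.1 (hA hc) d
  have hr : ∀ b ∈ B, ∀ c ∈ commutator A, ∀ d, φ.f d (b * c) = 0 := by
    intro b hb c hc d
    rw [φ.right, hφB d b hb, φ.comm_right hc, add_zero]
  let N : Subgroup (DD φ) :=
    { carrier := {p | ∃ b ∈ B, ∃ c ∈ commutator A, p = ⟨1, b * c, χ c⟩}
      one_mem' := ⟨1, B.one_mem, 1, Subgroup.one_mem _, by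
        ext
        · rfl
        · simp [DD.one_v]
        · simp [DD.one_t, χ1]⟩
      mul_mem' := by
        rintro _ _ ⟨b, hb, c, hc, rfl⟩ ⟨b', hb', c', hc', rfl⟩
        refine ⟨b * b', B.mul_mem hb hb', c * c', Subgroup.mul_mem _ hc hc', ?_⟩
        ext
        · simp [DD.mul_y]
        · simp only [DD.mul_v]
          calc b * c * (b' * c') = b * (c * b') * c' := by group
            _ = _ := by rw [← hcen c hc b']; group
        · simp only [DD.mul_t]
          rw [hr b hb c hc, hr b hb c hc, hχ c hc c' hc']; abel
      inv_mem' := by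
        rintro _ ⟨b, hb, c, hc, rfl⟩
        refine ⟨b⁻¹, B.inv_mem hb, c⁻¹, Subgroup.inv_mem _ hc, ?_⟩
        ext
        · simp [DD.inv_y]
        · simp only [DD.inv_v]
          rw [mul_inv_rev, hcen c⁻¹ (Subgroup.inv_mem _ hc)]
        · simp only [DD.inv_t]
          rw [hr b hb c hc, hr b hb c hc, χinv c hc]; abel }
  haveI : N.Normal := by
    constructor
    rintro _ ⟨b, hb, c, hc, rfl⟩ q
    have hd : ⁅b, q.v⁆⁻¹ ∈ commutator A := Subgroup.inv_mem _ (comm_mem _ _)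
    refine ⟨b, hb, c * ⁅b, q.v⁆⁻¹, Subgroup.mul_mem _ hc hd, ?_⟩
    rw [mul_inv_eq_iff_eq_mul]
    ext
    · simp [DD.mul_y]
    · simp only [DD.mul_v]
      have e1 := hcen _ hd b
      calc q.v * (b * c) = ⁅b, q.v⁆⁻¹ * b * (q.v * c) := by
            simp only [commutatorElement_def]; group
        _ = b * ⁅b, q.v⁆⁻¹ * (c * q.v) := by rw [e1, hcen c hc q.v]
        _ = b * (⁅b, q.v⁆⁻¹ * c) * q.v := by group
        _ = _ := by rw [hcen c hc]
    · simp only [DD.mul_t]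
      rw [hr b hb _ (Subgroup.mul_mem _ hc hd), hr b hb _ (Subgroup.mul_mem _ hc hd), φ.one_left,
        φ.left, φ.comm_left hc, hχ c hc _ hd, χinv _ (comm_mem _ _), ← hφ, hφB _ b hb]
      abel
  let π : DD φ →* DD φ ⧸ N := QuotientGroup.mk' N
  have hC : IsNil2 (DD φ ⧸ N) :=
    nil2_of_surjective π (QuotientGroup.mk'_surjective N) (DD.nil2 hA)
  let f0 : A →* DD φ := MonoidHom.mk' (fun a => ⟨a, a, 0⟩) (fun a b => by
    ext
    · simp [DD.mul_y]
    · simp [DD.mul_v]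
    · simp [DD.mul_t])
  let g0 : A →* DD φ := MonoidHom.mk' (fun a => ⟨a, 1, 0⟩) (fun a b => by
    ext
    · simp [DD.mul_y]
    · simp [DD.mul_v]
    · simp [DD.mul_t, φ.one_right])
  have hfg : ∀ a, (g0 a)⁻¹ * f0 a = ⟨1, a, 0⟩ := by
    intro a
    ext
    · simp [DD.mul_y, DD.inv_y, f0, g0]
    · simp [DD.mul_v, DD.inv_v, f0, g0]
    · simp [DD.mul_t, DD.inv_t, DD.inv_v, f0, g0, φ.one_right, φ.one_left]
  have h1 : ∀ a, π.comp g0 a = π.comp f0 a ↔ (⟨1, a, 0⟩ : DD φ) ∈ N := by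
    intro a
    rw [← hfg a]
    exact QuotientGroup.eq
  have h2 := ha (DD φ ⧸ N) hC (π.comp g0) (π.comp f0) (by
    intro b hb
    rw [h1]
    exact ⟨b, hb, 1, Subgroup.one_mem _, by rw [mul_one, χ1]⟩)
  rw [h1] at h2
  obtain ⟨b, hb, c, hc, e⟩ := h2
  rw [DD.ext_iff] at e
  exact ⟨b, hb, c, hc, e.2.1, e.2.2.symm⟩

/-- Rational circle to real circle. -/
theorem circle_map : ∃ j : AddCircle (1 : ℚ) →+ AddCircle (1 : ℝ), Function.Injective j := by
  refine ⟨QuotientAddGroup.map _ _ (Rat.castHom ℝ).toAddMonoidHom ?_, ?_⟩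
  · rintro _ ⟨k, rfl⟩
    exact ⟨k, by simp⟩
  · rw [injective_iff_map_eq_zero]
    intro z hz
    obtain ⟨q, rfl⟩ := QuotientAddGroup.mk_surjective z
    obtain ⟨k, hk⟩ := (QuotientAddGroup.eq_zero_iff _).1 hz
    refine (QuotientAddGroup.eq_zero_iff _).2 ⟨k, ?_⟩
    simp at hk ⊢
    exact_mod_cast hk

/-- Separating characters on the center. -/
theorem exists_chi {A : Type*} [Group A] (L : Subgroup (Subgroup.center A)) (c : A)
    (hc : c ∈ Subgroup.center A) (hcL : (⟨c, hc⟩ : Subgroup.center A) ∉ L) :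
    ∃ χ : A → AddCircle (1 : ℝ),
      (∀ c ∈ Subgroup.center A, ∀ c' ∈ Subgroup.center A, χ (c * c') = χ c + χ c') ∧
      (∀ d : Subgroup.center A, d ∈ L → χ d = 0) ∧ χ c ≠ 0 := by
  classical
  obtain ⟨j, hj⟩ := circle_map
  let Q := Additive (Subgroup.center A ⧸ L)
  let z : Q := Additive.ofMul (QuotientGroup.mk' L ⟨c, hc⟩)
  have hz : z ≠ 0 := by
    intro h
    apply hcL
    exact (QuotientGroup.eq_one_iff _).1 (congrArg Additive.toMul h)
  obtain ⟨ψ, hψ⟩ := CharacterModule.exists_character_apply_ne_zero_of_ne_zero hz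
  let ψ' : Q →+ AddCircle (1 : ℚ) := ψ
  refine ⟨fun a => if h : a ∈ Subgroup.center A then
    j (ψ' (Additive.ofMul (QuotientGroup.mk' L ⟨a, h⟩))) else 0, ?_, ?_, ?_⟩
  · intro a ha b hb
    beta_reduce
    rw [dif_pos ha, dif_pos hb, dif_pos (Subgroup.mul_mem _ ha hb), ← map_add, ← map_add]
    rfl
  · intro d hd
    beta_reduce
    rw [dif_pos d.2]
    have : QuotientGroup.mk' L (⟨d, d.2⟩ : Subgroup.center A) = 1 :=
      (QuotientGroup.eq_one_iff _).2 hd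
    rw [this, ofMul_one, map_zero, map_zero]
  · beta_reduce
    rw [dif_pos hc]
    intro h
    apply hψ
    exact (injective_iff_map_eq_zero j).1 hj _ h

/-- If the condition on commutators holds then the subgroup is its own dominion. -/
theorem dominion_eq {A : Type u} [Group A] (hA : IsNil2 A) (B : Subgroup A)
    (H : ∀ (q : ℕ) (r s : A), r ^ q ∈ B ⊔ commutator A → s ^ q ∈ B ⊔ commutator A →
      ⁅r, s⁆ ^ q ∈ B) : Dominion B = (B : Set A) := by
  apply Set.Subset.antisymm
  swap
  · intro b hb C _ _ f g hfg
    exact hfg b hb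
  intro a ha
  obtain ⟨b, hb, c, hc, rfl, -⟩ := dominion_step (T := ℤ) hA B (fun _ => 0) (by simp)
    ⟨fun _ _ => 0, by simp, by simp⟩ (by simp) (by simp) a ha
  by_cases hcB : c ∈ B
  · exact B.mul_mem hb hcB
  exfalso
  let L : Subgroup (Subgroup.center A) := (B ⊓ commutator A).subgroupOf (Subgroup.center A)
  obtain ⟨χ, hχ1, hχ2, hχ3⟩ := exists_chi L c (hA hc) (by
    intro h
    exact hcB (Subgroup.mem_subgroupOf.1 h).1)
  have hχL : ∀ d ∈ B, d ∈ commutator A → χ d = 0 := fun d hd hd' =>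
    hχ2 ⟨d, hA hd'⟩ (Subgroup.mem_subgroupOf.2 ⟨hd, hd'⟩)
  have hχ : ∀ c ∈ commutator A, ∀ c' ∈ commutator A, χ (c * c') = χ c + χ c' :=
    fun c hc c' hc' => hχ1 c (hA hc) c' (hA hc')
  let w : Bil A (AddCircle (1 : ℝ)) := ⟨fun a c => χ ⁅a, c⁆,
    fun a a' c => by rw [comm_mul_left hA, hχ _ (comm_mem _ _) _ (comm_mem _ _)],
    fun a c c' => by rw [comm_mul_right hA, hχ _ (comm_mem _ _) _ (comm_mem _ _)]⟩
  have χ1 : χ 1 = 0 := hχL 1 B.one_mem (Subgroup.one_mem _)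
  have χpow : ∀ d ∈ commutator A, ∀ q : ℕ, χ (d ^ q) = (q : ℤ) • χ d := by
    intro d hd q
    induction q with
    | zero => simp [χ1]
    | succ q ih =>
      rw [pow_succ, hχ _ (Subgroup.pow_mem _ hd q) _ hd, ih]
      push_cast
      rw [add_smul, one_smul]
  haveI : Fact ((0 : ℝ) < 1) := ⟨zero_lt_one⟩
  obtain ⟨φ, h1, h2⟩ := split_all B w
    (by
      intro a
      change χ ⁅a, a⁆ = 0
      rw [commutatorElement_self, χ1])
    (by
      intro q r s hr hs
      change (q : ℤ) • χ ⁅r, s⁆ = 0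
      rw [← χpow _ (comm_mem _ _)]
      exact hχL _ (H q r s hr hs) (Subgroup.pow_mem _ (comm_mem _ _) q))
  obtain ⟨b', hb', c', hc', e, e0⟩ := dominion_step hA B χ hχ φ h1 h2 _ ha
  apply hχ3
  have e1 : c = (b⁻¹ * b') * c' := by
    rw [mul_assoc, ← e]; group
  have e2 : b⁻¹ * b' ∈ commutator A := by
    have : b⁻¹ * b' = c * c'⁻¹ := by rw [e1]; group
    rw [this]
    exact Subgroup.mul_mem _ hc (Subgroup.inv_mem _ hc')
  rw [e1, hχ _ e2 _ hc', e0, add_zero]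
  exact hχL _ (B.mul_mem (B.inv_mem hb) hb') e2

end Nil2Aux

/-- A nil-2 group `G` is absolutely closed in `N₂` iff for all `x y ∈ G`, every prime
`p` and every `α ≥ 1`, condition (2.10) or (2.11) holds with `n = p ^ α`. -/
theorem absolutelyClosed_iff_conditions_primePow {G : Type u} [Group G] (hG : IsNil2 G) :
    IsAbsolutelyClosed G ↔
      ∀ (x y : G) (p : ℕ), p.Prime → ∀ α : ℕ, 1 ≤ α →
        (Cond210 x y (p ^ α) ∨ Cond211 x y (p ^ α)) := by
  constructor
  · intro hcl x y p hp α _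
    exact Nil2Aux.conds_of_closed hG hcl x y (p ^ α) (pow_ne_zero _ hp.ne_zero)
  · intro h A _ hA ι hι
    apply Nil2Aux.dominion_eq hA
    intro q
    apply Nil2Aux.comm_pow_mem_all hA
    intro p hp α hα r s hr hs
    have key : ∀ r : A, r ∈ ι.range ⊔ commutator A → ∃ x : G, r * (ι x)⁻¹ ∈ commutator A := by
      intro r hr
      rw [← SetLike.mem_coe, Subgroup.mul_normal, Set.mem_mul] at hr
      obtain ⟨_, ⟨x, rfl⟩, c, hc, rfl⟩ := hr
      refine ⟨x, ?_⟩
      exact (inferInstance : (commutator A).Normal).conj_mem c hc (ι x)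
    obtain ⟨x, hx⟩ := key _ hr
    obtain ⟨y, hy⟩ := key _ hs
    exact Nil2Aux.comm_pow_mem_of_conds hG hA ι hι (p ^ α) x y (h x y p hp α hα) r s hx hy
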